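/- arXiv:math/0410110 — 2 statements merged into one kernel-verified Lean document; each statement's English description precedes it below -/
import Mathlib

section
/- Let N ≥ 1 and define, for s, t ∈ (0,∞)^N, σ(s,t) = ∏_{i=1}^N (s_i ∧ t_i), σ²(t) = σ(t,t) = ∏_{i=1}^N t_i, and ρ(s,t) = σ(s,t)/(σ(s)σ(t)) (the covariance structure of the Brownian sheet). Then for all 0 < a < b < ∞ there exist δ, ε > 0 and finite positive constants C_1,…,C_5 such that for all s, t ∈ [a,b]^N: C_1 ≤ σ²(t) ≤ C_2; |1 − σ(s,t)/σ²(s)| ≤ C_3 ‖t−s‖ if ‖t−s‖ ≤ δ; C_4 ‖t−s‖ ≤ 1 − ρ²(s,t) ≤ C_5 ‖t−s‖ if ‖t−s‖ ≤ δ; and |ρ(s,t)| < 1 − ε if ‖t−s‖ > δ. (This is Hypothesis A1 with α = 1/2 and γ = 1 for the Brownian sheet covariance.) -/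
open MeasureTheory ProbabilityTheory
open scoped ENNReal NNReal

noncomputable section

/-- Euclidean space `ℝ^n`. -/
abbrev Rv (n : ℕ) := EuclideanSpace ℝ (Fin n)

/-- The cube `[a,b]^N`. -/
def box (N : ℕ) (a b : ℝ) : Set (Rv N) := {t | ∀ i, t i ∈ Set.Icc a b}

/-- The open positive orthant `(0,∞)^N`. -/
def posOrthant (N : ℕ) : Set (Rv N) := {t | ∀ i, 0 < t i}

theorem one_sub_prod_le_sum_one_sub {ι : Type*} (A : Finset ι) (f : ι → ℝ)
    (h0 : ∀ i, 0 ≤ f i) (h1 : ∀ i, f i ≤ 1) :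
    1 - ∏ i ∈ A, f i ≤ ∑ i ∈ A, (1 - f i) := by
  classical
  induction A using Finset.induction_on with
  | empty => simp
  | insert j A hj ih =>
    rw [Finset.prod_insert hj, Finset.sum_insert hj]
    have hp0 : 0 ≤ ∏ i ∈ A, f i := Finset.prod_nonneg fun i _ => h0 i
    have hp1 : ∏ i ∈ A, f i ≤ 1 := Finset.prod_le_one (fun i _ => h0 i) fun i _ => h1 i
    nlinarith [mul_nonneg (sub_nonneg.2 (h1 j)) (sub_nonneg.2 hp1)]

theorem sum_one_sub_le_card_mul {ι : Type*} [Fintype ι] (f : ι → ℝ)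
    (h0 : ∀ i, 0 ≤ f i) (h1 : ∀ i, f i ≤ 1) :
    ∑ i, (1 - f i) ≤ Fintype.card ι * (1 - ∏ i, f i) := by
  classical
  have h : ∀ j ∈ Finset.univ, 1 - f j ≤ 1 - ∏ i, f i := by
    intro j hj
    rw [← Finset.mul_prod_erase _ f hj]
    have : ∏ i ∈ Finset.univ.erase j, f i ≤ 1 :=
      Finset.prod_le_one (fun i _ => h0 i) fun i _ => h1 i
    nlinarith [h0 j]
  simpa using Finset.sum_le_card_nsmul _ _ _ h

theorem norm_le_sum_abs {N : ℕ} (x : Rv N) : ‖x‖ ≤ ∑ i, |x i| := by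
  rw [EuclideanSpace.norm_eq]
  refine Real.sqrt_le_iff.2 ⟨Finset.sum_nonneg fun i _ => abs_nonneg _, ?_⟩
  simpa using Finset.sum_sq_le_sq_sum_of_nonneg (s := Finset.univ) (f := fun i => |x i|)
    fun i _ => abs_nonneg _

theorem sum_abs_le_mul_norm {N : ℕ} (x : Rv N) : ∑ i, |x i| ≤ N * ‖x‖ := by
  simpa using Finset.sum_le_card_nsmul Finset.univ (fun i => |x i|) ‖x‖
    fun i _ => PiLp.norm_apply_le x i

theorem one_sub_min_div_le {a s t : ℝ} (ha : 0 < a) (hs : a ≤ s) :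
    1 - min s t / s ≤ |t - s| / a := by
  have hs0 : 0 < s := ha.trans_le hs
  calc 1 - min s t / s = (s - min s t) / s := by field_simp
    _ ≤ |t - s| / a := by
        refine div_le_div₀ (abs_nonneg _) ?_ ha hs
        rcases min_cases s t with ⟨h, _⟩ | ⟨h, _⟩ <;> rw [h]
        · simp
        · linarith [neg_le_abs (t - s)]

theorem one_sub_min_sq_div {s t : ℝ} (hs : 0 < s) (ht : 0 < t) :
    1 - min s t ^ 2 / (s * t) = |t - s| / max s t := by
  rcases le_total s t with h | h
  · rw [min_eq_left h, max_eq_right h, abs_of_nonneg (sub_nonneg.2 h)]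
    field_simp
  · rw [min_eq_right h, max_eq_left h, abs_of_nonpos (sub_nonpos.2 h)]
    field_simp
    ring

/-- **Theorem 3.6** (Dalang–Nualart), covariance estimates: the Brownian sheet
covariance `σ(s,t) = ∏ᵢ (sᵢ ∧ tᵢ)` satisfies Hypothesis A1 with `α = 1/2`, `γ = 1`. -/
theorem statement9 (N : ℕ) (hN : 1 ≤ N) :
    ∀ a b : ℝ, 0 < a → a < b →
      ∃ δ ε C1 C2 C3 C4 C5 : ℝ,
        0 < δ ∧ 0 < ε ∧ 0 < C1 ∧ 0 < C2 ∧ 0 < C3 ∧ 0 < C4 ∧ 0 < C5 ∧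
        ∀ s ∈ box N a b, ∀ t ∈ box N a b,
          (C1 ≤ (∏ i, min (t i) (t i)) ∧ (∏ i, min (t i) (t i)) ≤ C2) ∧
          (‖t - s‖ ≤ δ →
            |1 - (∏ i, min (s i) (t i)) / (∏ i, min (s i) (s i))| ≤ C3 * ‖t - s‖) ∧
          (‖t - s‖ ≤ δ →
            C4 * ‖t - s‖
                ≤ 1 - ((∏ i, min (s i) (t i)) /
                    (Real.sqrt (∏ i, min (s i) (s i)) *
                      Real.sqrt (∏ i, min (t i) (t i)))) ^ 2 ∧
            1 - ((∏ i, min (s i) (t i)) /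
                    (Real.sqrt (∏ i, min (s i) (s i)) *
                      Real.sqrt (∏ i, min (t i) (t i)))) ^ 2
                ≤ C5 * ‖t - s‖) ∧
          (δ < ‖t - s‖ →
            |(∏ i, min (s i) (t i)) /
                (Real.sqrt (∏ i, min (s i) (s i)) *
                  Real.sqrt (∏ i, min (t i) (t i)))| < 1 - ε) := by
  intro a b ha hab
  have hb : 0 < b := ha.trans hab
  have hN0 : (0 : ℝ) < N := by exact_mod_cast hN
  refine ⟨b, 1 / (4 * N), a ^ N, b ^ N, N / a, 1 / (N * b), N / a, hb, by positivity,
    by positivity, by positivity, by positivity, by positivity, by positivity, ?_⟩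
  intro s hs t ht
  simp only [min_self]
  have hs0 : ∀ i, 0 < s i := fun i => ha.trans_le (hs i).1
  have ht0 : ∀ i, 0 < t i := fun i => ha.trans_le (ht i).1
  have hm0 : ∀ i, 0 < min (s i) (t i) := fun i => lt_min (hs0 i) (ht0 i)
  have hS : 0 < ∏ i, s i := Finset.prod_pos fun i _ => hs0 i
  have hT : 0 < ∏ i, t i := Finset.prod_pos fun i _ => ht0 i
  have hM : 0 < ∏ i, min (s i) (t i) := Finset.prod_pos fun i _ => hm0 i
  have hsum : ∑ i, |t i - s i| / a ≤ N / a * ‖t - s‖ := by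
    rw [← Finset.sum_div, div_mul_eq_mul_div]
    gcongr
    exact sum_abs_le_mul_norm (t - s)
  set ρ := (∏ i, min (s i) (t i)) / (√(∏ i, s i) * √(∏ i, t i)) with hρ
  have hρ0 : 0 ≤ ρ := by positivity
  have hρsq : ρ ^ 2 = ∏ i, min (s i) (t i) ^ 2 / (s i * t i) := by
    rw [hρ, div_pow, mul_pow, Real.sq_sqrt hS.le, Real.sq_sqrt hT.le, Finset.prod_div_distrib,
      Finset.prod_mul_distrib, Finset.prod_pow]
  have hg0 : ∀ i, 0 ≤ min (s i) (t i) ^ 2 / (s i * t i) := fun i =>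
    div_nonneg (sq_nonneg _) (mul_pos (hs0 i) (ht0 i)).le
  have hg : ∀ i, 1 - min (s i) (t i) ^ 2 / (s i * t i) = |t i - s i| / max (s i) (t i) :=
    fun i => one_sub_min_sq_div (hs0 i) (ht0 i)
  have hg1 : ∀ i, min (s i) (t i) ^ 2 / (s i * t i) ≤ 1 := fun i =>
    sub_nonneg.1 <| (hg i).symm ▸ div_nonneg (abs_nonneg _) ((hs0 i).le.trans (le_max_left _ _))
  have hlower : 1 / (N * b) * ‖t - s‖ ≤ 1 - ρ ^ 2 := by
    have h1 : ‖t - s‖ / b ≤ N * (1 - ρ ^ 2) := calc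
      ‖t - s‖ / b ≤ ∑ i, |t i - s i| / b := by
        rw [← Finset.sum_div]
        gcongr
        exact norm_le_sum_abs (t - s)
      _ ≤ ∑ i, (1 - min (s i) (t i) ^ 2 / (s i * t i)) := by
        refine Finset.sum_le_sum fun i _ => ?_
        rw [hg]
        exact div_le_div_of_nonneg_left (abs_nonneg _) ((hs0 i).trans_le (le_max_left _ _))
          (max_le (hs i).2 (ht i).2)
      _ ≤ N * (1 - ρ ^ 2) := by
        rw [hρsq]
        simpa using sum_one_sub_le_card_mul _ hg0 hg1
    calc 1 / (N * b) * ‖t - s‖ = ‖t - s‖ / b / N := by field_simp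
      _ ≤ 1 - ρ ^ 2 := (div_le_iff₀' hN0).2 h1
  refine ⟨⟨?_, ?_⟩, fun _ => ?_, fun _ => ⟨hlower, ?_⟩, fun hd => ?_⟩
  · simpa using Finset.prod_le_prod (s := Finset.univ) (fun _ _ => ha.le) fun i _ => (ht i).1
  · simpa using Finset.prod_le_prod (s := Finset.univ) (fun i _ => (ht0 i).le) fun i _ => (ht i).2
  · rw [← Finset.prod_div_distrib]
    have hf0 : ∀ i, 0 ≤ min (s i) (t i) / s i := fun i => div_nonneg (hm0 i).le (hs0 i).le
    have hf1 : ∀ i, min (s i) (t i) / s i ≤ 1 := fun i =>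
      div_le_one_of_le₀ (min_le_left _ _) (hs0 i).le
    rw [abs_of_nonneg (sub_nonneg.2 (Finset.prod_le_one (fun i _ => hf0 i) fun i _ => hf1 i))]
    exact (one_sub_prod_le_sum_one_sub _ _ hf0 hf1).trans <|
      (Finset.sum_le_sum fun i _ => one_sub_min_div_le ha (hs i).1).trans hsum
  · rw [hρsq]
    refine (one_sub_prod_le_sum_one_sub _ _ hg0 hg1).trans <|
      (Finset.sum_le_sum fun i _ => ?_).trans hsum
    rw [hg]
    exact div_le_div_of_nonneg_left (abs_nonneg _) ha ((hs i).1.trans (le_max_left _ _))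
  · rw [abs_of_nonneg hρ0]
    have hgap : 1 / (N : ℝ) < 1 - ρ ^ 2 := by
      refine lt_of_lt_of_le ?_ hlower
      calc 1 / (N : ℝ) = 1 / (N * b) * b := by field_simp
        _ < 1 / (N * b) * ‖t - s‖ := by gcongr
    have hN1 : 1 / (N : ℝ) ≤ 1 := div_le_one_of_le₀ (by exact_mod_cast hN) hN0.le
    have hε : 1 / (4 * (N : ℝ)) = 1 / N / 4 := by field_simp
    rw [hε]
    refine lt_of_pow_lt_pow_left₀ 2 (by linarith) ?_
    have hε0 : 0 < 1 / (N : ℝ) := by positivity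
    nlinarith
end
end

section
/- Fix H ∈ (0,1), N ≥ 1 and 0 < a < b < ∞. Then there exist δ > 0 and a finite constant C > 0 such that for all s, t ∈ [a,b]^N with ‖t − s‖ ≤ δ: |1 − ∏_{i=1}^N ((s_i^{2H} + t_i^{2H} − |t_i − s_i|^{2H})/2) / ∏_{i=1}^N s_i^{2H}| ≤ C ‖t − s‖^{min(2H,1)}. -/
open MeasureTheory ProbabilityTheory
open scoped ENNReal NNReal

noncomputable section

/-- Away from the origin, real powers are Lipschitz on compact intervals. -/
lemma exists_lipschitzOnWith_rpow (p a b : ℝ) (ha : 0 < a) :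
    ∃ K : ℝ≥0, LipschitzOnWith K (fun x : ℝ => x ^ p) (Set.Icc a b) := by
  refine LocallyLipschitzOn.exists_lipschitzOnWith_of_compact isCompact_Icc fun x hx => ?_
  have hx0 : x ≠ 0 := (ha.trans_le hx.1).ne'
  obtain ⟨K, u, hu, hK⟩ :=
    (Real.hasStrictDerivAt_rpow_const_of_ne hx0 p).hasStrictFDerivAt.exists_lipschitzOnWith
  exact ⟨K, u, mem_nhdsWithin_of_mem_nhds hu, hK⟩

/-- A finite product of factors within `y` of `1` is within `n y exp (n y)` of `1`. -/
lemma abs_one_sub_prod_le {ι : Type*} [Fintype ι] (r : ι → ℝ) (y : ℝ)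
    (h : ∀ i, |1 - r i| ≤ y) :
    |1 - ∏ i, r i| ≤ Fintype.card ι * y * Real.exp (Fintype.card ι * y) := by
  have hprod := Finset.norm_prod_one_add_sub_one_le Finset.univ fun i => r i - 1
  simp only [add_sub_cancel, Real.norm_eq_abs] at hprod
  have hsum : ∑ i, |r i - 1| ≤ Fintype.card ι * y := by
    calc ∑ i, |r i - 1| ≤ ∑ _i : ι, y :=
          Finset.sum_le_sum fun i _ => by rw [abs_sub_comm]; exact h i
      _ = Fintype.card ι * y := by simp
  set z := Fintype.card ι * y
  have hz : Real.exp z - 1 ≤ z * Real.exp z := by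
    have h1 := mul_le_mul_of_nonneg_right (Real.add_one_le_exp (-z)) (Real.exp_pos z).le
    rw [← Real.exp_add, neg_add_cancel, Real.exp_zero] at h1
    linarith
  rw [abs_sub_comm]
  linarith [Real.exp_le_exp.mpr hsum]

/-- One coordinate of the normalized fractional Brownian sheet covariance. -/
lemma abs_one_sub_fbm_ratio_le {p a b x y d : ℝ} {L : ℝ≥0} (hp : 0 < p) (ha : 0 < a)
    (hL : LipschitzOnWith L (fun x : ℝ => x ^ p) (Set.Icc a b))
    (hx : x ∈ Set.Icc a b) (hy : y ∈ Set.Icc a b) (hd : |y - x| ≤ d) (hd1 : d ≤ 1) :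
    |1 - (x ^ p + y ^ p - |y - x| ^ p) / 2 / x ^ p| ≤
      (L + 1) / (2 * a ^ p) * d ^ min p 1 := by
  have hd0 : 0 ≤ d := (abs_nonneg _).trans hd
  have hγ : 0 ≤ min p 1 := le_min hp.le zero_le_one
  have hap : 0 < a ^ p := Real.rpow_pos_of_pos ha p
  have hax : a ^ p ≤ x ^ p := Real.rpow_le_rpow ha.le hx.1 hp.le
  have hxp : 0 < x ^ p := hap.trans_le hax
  have hlip : |y ^ p - x ^ p| ≤ L * d ^ min p 1 := by
    have h1 : |y ^ p - x ^ p| ≤ L * |y - x| := hL.norm_sub_le hy hx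
    have h2 : d ≤ d ^ min p 1 := by
      simpa using Real.rpow_le_rpow_of_exponent_ge' hd0 hd1 hγ (min_le_right p 1)
    exact h1.trans (mul_le_mul_of_nonneg_left (hd.trans h2) L.coe_nonneg)
  have hpow : |y - x| ^ p ≤ d ^ min p 1 :=
    (Real.rpow_le_rpow (abs_nonneg _) hd hp.le).trans
      (Real.rpow_le_rpow_of_exponent_ge' hd0 hd1 hγ (min_le_left p 1))
  have hpow0 : 0 ≤ |y - x| ^ p := Real.rpow_nonneg (abs_nonneg _) p
  have hnum : |x ^ p - y ^ p + |y - x| ^ p| ≤ (L + 1) * d ^ min p 1 := by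
    rw [abs_le] at hlip ⊢
    constructor <;> linarith [hlip.1, hlip.2]
  have heq : 1 - (x ^ p + y ^ p - |y - x| ^ p) / 2 / x ^ p =
      (x ^ p - y ^ p + |y - x| ^ p) / (2 * x ^ p) := by
    field_simp
    ring
  rw [heq, abs_div, abs_of_pos (mul_pos two_pos hxp), div_mul_eq_mul_div]
  gcongr

/-- Condition (3.2) of Hypothesis A1 with `γ = min(2H,1)` for the fractional Brownian
sheet covariance. -/
theorem statement17 (H : ℝ) (hH : H ∈ Set.Ioo (0 : ℝ) 1)
    (N : ℕ) (hN : 1 ≤ N) (a b : ℝ) (ha : 0 < a) (hab : a < b) :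
    ∃ δ C : ℝ, 0 < δ ∧ 0 < C ∧
      ∀ s ∈ box N a b, ∀ t ∈ box N a b, ‖t - s‖ ≤ δ →
        |1 - (∏ i, (s i ^ (2 * H) + t i ^ (2 * H) - |t i - s i| ^ (2 * H)) / 2) /
              (∏ i, s i ^ (2 * H))|
          ≤ C * ‖t - s‖ ^ min (2 * H) 1 := by
  obtain ⟨hH0, -⟩ := hH
  have hp : 0 < 2 * H := by linarith
  obtain ⟨L, hL⟩ := exists_lipschitzOnWith_rpow (2 * H) a b ha
  set K : ℝ := (L + 1) / (2 * a ^ (2 * H)) with hKdef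
  have hK : 0 < K := by positivity
  have hN0 : (0 : ℝ) < N := by exact_mod_cast hN
  refine ⟨1, N * K * Real.exp (N * K), one_pos, by positivity, fun s hs t ht hst => ?_⟩
  have hcoord : ∀ i, |1 - (s i ^ (2 * H) + t i ^ (2 * H) - |t i - s i| ^ (2 * H)) / 2 /
      s i ^ (2 * H)| ≤ K * ‖t - s‖ ^ min (2 * H) 1 := fun i =>
    abs_one_sub_fbm_ratio_le hp ha hL (hs i) (ht i) (PiLp.norm_apply_le (t - s) i) hst
  have hx1 : ‖t - s‖ ^ min (2 * H) 1 ≤ 1 :=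
    Real.rpow_le_one (norm_nonneg _) hst (le_min hp.le zero_le_one)
  have hx0 : 0 ≤ ‖t - s‖ ^ min (2 * H) 1 := Real.rpow_nonneg (norm_nonneg _) _
  rw [← Finset.prod_div_distrib]
  refine (abs_one_sub_prod_le _ _ hcoord).trans ?_
  rw [Fintype.card_fin]
  set x := ‖t - s‖ ^ min (2 * H) 1
  calc N * (K * x) * Real.exp (N * (K * x)) ≤ N * (K * x) * Real.exp (N * (K * 1)) := by
        gcongr
    _ = N * K * Real.exp (N * K) * x := by rw [mul_one]; ring
end
end
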